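/- (Recoverability of standard AA from EG-AA.) Fix d, m ≥ 1, points x_{k-m}, …, x_k ∈ ℝ^d, a gradient map ∇f : ℝ^d → ℝ^d, step size β > 0, coefficients θ ∈ ℝ^m with momentum coefficients γ^{(j)} = θ_{m-j} - θ_{m-j+1} (θ_0 = θ_{m+1} = 0), and masses M_curr = ½(1 + ∑_{j=1}^m j² γ^{(j)}), M_prev ∈ ℝ. Suppose the Energy Guard is inactive, i.e., M_curr - M_prev ≤ δ_max and M_curr ≥ 0 (so the scaling factor ρ = 1), and the Hessian damping is off, η = 0 (so D_k = 0). Then the EG-AA update x_{k+1} = y_{k+1} + ∑_{j=1}^m γ^{(j)} (y_{k+1} - y_{k-j+1}) + D_k coincides exactly with the standard Type-II Anderson Acceleration update x_{k+1} = x_k + r(x_k) - (X_k + R_k)θ, where r(x) = -β∇f(x) and y_{i+1} = x_i + r(x_i). -/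

import Mathlib

/-- Summation by parts for the differences of a scalar sequence against `c - a i`. -/
theorem sum_range_sub_smul_sub {R M : Type*} [Ring R] [AddCommGroup M] [Module R M]
    (θ : ℕ → R) (a : ℕ → M) (c : M) (n : ℕ) :
    ∑ i ∈ Finset.range n, (θ i - θ (i + 1)) • (c - a i)
      = θ 0 • (c - a 0) - θ n • (c - a n)
        - ∑ i ∈ Finset.range n, θ (i + 1) • (a (i + 1) - a i) := by
  induction n with
  | zero => simp
  | succ n ih =>
    rw [Finset.sum_range_succ, Finset.sum_range_succ, ih]
    simp only [sub_smul, smul_sub]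
    abel


/-- Recoverability of standard AA from EG-AA: when the Energy Guard is
inactive (`M_curr - M_prev ≤ δ_max` and `M_curr ≥ 0`, so `ρ = 1`) and the Hessian
damping is off (`η = 0`, so `D_k = 0`), the EG-AA update
`x_{k+1} = y_{k+1} + ∑_j γ^{(j)}(y_{k+1} - y_{k-j+1}) + D_k` coincides with the standard
Type-II AA update `x_{k+1} = x_k + r(x_k) - (X_k + R_k)θ`, where `r(x) = -β∇f(x)`,
`y_{i+1} = x_i + r(x_i)`, and `γ^{(j)} = θ_{m-j} - θ_{m-j+1}` with `θ_0 = θ_{m+1} = 0`. -/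
theorem egaa_recovers_aa (d m k : ℕ) (hm : 1 ≤ m) (hk : m ≤ k)
    (x : ℕ → EuclideanSpace ℝ (Fin d))
    (gradf : EuclideanSpace ℝ (Fin d) → EuclideanSpace ℝ (Fin d))
    (β : ℝ) (hβ : 0 < β)
    (θ : ℕ → ℝ) (hθ0 : θ 0 = 0) (hθtop : θ (m + 1) = 0)
    (γ : ℕ → ℝ) (hγ : ∀ j ∈ Finset.Icc 1 m, γ j = θ (m - j) - θ (m - j + 1))
    (Mcurr Mprev δmax : ℝ)
    (hMcurr : Mcurr = (1 / 2) * (1 + ∑ j ∈ Finset.Icc 1 m, (j : ℝ) ^ 2 * γ j))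
    (hguard : Mcurr - Mprev ≤ δmax) (hMpos : 0 ≤ Mcurr)
    (η : ℝ) (hη : η = 0)
    (r : EuclideanSpace ℝ (Fin d) → EuclideanSpace ℝ (Fin d))
    (hr : ∀ z, r z = -β • gradf z)
    (y : ℕ → EuclideanSpace ℝ (Fin d))
    (hy : ∀ i, y (i + 1) = x i + r (x i))
    (Dk : EuclideanSpace ℝ (Fin d))
    (hDk : Dk = -(η * Real.sqrt β) • (gradf (x k) - gradf (x (k - 1)))) :
    y (k + 1) + (∑ j ∈ Finset.Icc 1 m, γ j • (y (k + 1) - y (k - j + 1))) + Dk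
      = x k + r (x k)
        - ∑ j ∈ Finset.Icc 1 m, θ j •
            ((x (k - m + j) - x (k - m + j - 1))
              + (r (x (k - m + j)) - r (x (k - m + j - 1)))) := by
  have hD : Dk = 0 := by simp [hDk, hη]
  have hleft : ∑ j ∈ Finset.Icc 1 m, γ j • (y (k + 1) - y (k - j + 1))
      = ∑ i ∈ Finset.range m, (θ i - θ (i + 1)) • (y (k + 1) - y (k - m + i + 1)) := by
    refine Finset.sum_bij' (fun j _ => m - j) (fun i _ => m - i) ?_ ?_ ?_ ?_ ?_
    · intro j hj
      simp only [Finset.mem_Icc, Finset.mem_range] at *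
      omega
    · intro i hi
      simp only [Finset.mem_Icc, Finset.mem_range] at *
      omega
    · intro j hj
      simp only [Finset.mem_Icc] at *
      omega
    · intro i hi
      simp only [Finset.mem_range] at *
      omega
    · intro j hj
      rw [hγ j hj]
      simp only [Finset.mem_Icc] at hj
      rw [show k - m + (m - j) + 1 = k - j + 1 by omega]
  have hright : ∑ j ∈ Finset.Icc 1 m, θ j •
        ((x (k - m + j) - x (k - m + j - 1))
          + (r (x (k - m + j)) - r (x (k - m + j - 1))))
      = ∑ i ∈ Finset.range m, θ (i + 1) • (y (k - m + (i + 1) + 1) - y (k - m + i + 1)) := by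
    rw [← Finset.Ico_add_one_right_eq_Icc, Finset.sum_Ico_eq_sum_range, Nat.add_sub_cancel]
    refine Finset.sum_congr rfl fun i _ => ?_
    rw [Nat.add_comm 1 i, hy, hy, show k - m + (i + 1) - 1 = k - m + i by omega,
      add_sub_add_comm]
  have key := sum_range_sub_smul_sub θ (fun i => y (k - m + i + 1)) (y (k + 1)) m
  simp only [Nat.sub_add_cancel hk, sub_self, smul_zero, hθ0, zero_smul, zero_sub] at key
  rw [hD, add_zero, hleft, hright, key, ← hy k, sub_eq_add_neg]
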